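/- arXiv:0910.2378 — 2 statements merged into one kernel-verified Lean document; each statement's English description precedes it below -/
import Mathlib

section
/- Let X be a tree-graded space and P a piece of X. The projection π_P : X → P is a 1-Lipschitz retraction: π_P(p) = p for all p ∈ P, and d(π_P(x), π_P(y)) ≤ d(x, y) for all x, y ∈ X. -/
open Set Metric

section Core

variable {X : Type*} [MetricSpace X]

/-- A geodesic segment parametrized by the interval `[a, b]`:
an isometric embedding of `[a, b]` into `X`. -/
def IsGeodesicSegment (γ : ℝ → X) (a b : ℝ) : Prop :=
  ∀ s ∈ Set.Icc a b, ∀ t ∈ Set.Icc a b, dist (γ s) (γ t) = |s - t|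

/-- A metric space is geodesic if every two points are joined by a geodesic. -/
def GeodesicSpace (X : Type*) [MetricSpace X] : Prop :=
  ∀ x y : X, ∃ γ : ℝ → X, IsGeodesicSegment γ 0 (dist x y) ∧ γ 0 = x ∧ γ (dist x y) = y

/-- A subset is geodesic if every two of its points are joined by a geodesic of `X`
contained in the subset. -/
def IsGeodesicSubset (S : Set X) : Prop :=
  ∀ x ∈ S, ∀ y ∈ S, ∃ γ : ℝ → X, IsGeodesicSegment γ 0 (dist x y) ∧ γ 0 = x ∧
    γ (dist x y) = y ∧ ∀ t ∈ Set.Icc (0 : ℝ) (dist x y), γ t ∈ S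

/-- A (complete geodesic) metric space is tree-graded with respect to a collection `PX`
of closed geodesic subsets (pieces) covering `X` if every two different pieces meet in
at most one point (T₁) and every simple loop (injective continuous image of a circle)
is contained in one piece (T₂''). -/
structure IsTreeGraded (X : Type*) [MetricSpace X] (PX : Set (Set X)) : Prop where
  nonempty : ∀ P ∈ PX, P.Nonempty
  closed : ∀ P ∈ PX, IsClosed P
  geodesicSub : ∀ P ∈ PX, IsGeodesicSubset P
  covers : ∀ x : X, ∃ P ∈ PX, x ∈ P
  t1 : ∀ P ∈ PX, ∀ Q ∈ PX, P ≠ Q → (P ∩ Q).Subsingleton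
  t2 : ∀ loop : AddCircle (1 : ℝ) → X, Continuous loop → Function.Injective loop →
    ∃ P ∈ PX, Set.range loop ⊆ P

end Core

section ArcJoined

variable {X : Type*} [MetricSpace X]

/-- The points `x` and `y` are joined by a (possibly degenerate) arc contained in `S`. -/
def ArcJoined (S : Set X) (x y : X) : Prop :=
  ∃ (f : ℝ → X) (l : ℝ), 0 ≤ l ∧ Continuous f ∧ InjOn f (Icc 0 l) ∧ f 0 = x ∧ f l = y ∧
    MapsTo f (Icc 0 l) S

theorem ArcJoined.mono {S T : Set X} {x y : X} (h : ArcJoined S x y) (hST : S ⊆ T) :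
    ArcJoined T x y := by
  obtain ⟨f, l, hl, hc, hi, h0, h1, hm⟩ := h
  exact ⟨f, l, hl, hc, hi, h0, h1, hm.mono_right hST⟩

theorem ArcJoined.symm {S : Set X} {x y : X} (h : ArcJoined S x y) : ArcJoined S y x := by
  obtain ⟨f, l, hl, hc, hi, h0, h1, hm⟩ := h
  have hmaps : ∀ t ∈ Icc 0 l, l - t ∈ Icc 0 l := fun t ht =>
    ⟨by linarith [ht.2], by linarith [ht.1]⟩
  refine ⟨fun t => f (l - t), l, hl, hc.comp (by fun_prop), ?_, by simpa using h1,
    by simpa using h0, fun t ht => hm (hmaps t ht)⟩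
  intro s hs t ht hst
  have := hi (hmaps s hs) (hmaps t ht) hst
  linarith

theorem ArcJoined.trans {S : Set X} {x y z : X} (h : ArcJoined S x y) (h' : ArcJoined S y z) :
    ArcJoined S x z := by
  obtain ⟨f, l, hl, hfc, hfi, hf0, hf1, hfm⟩ := h
  obtain ⟨g, m, hm, hgc, hgi, hg0, hg1, hgm⟩ := h'
  have hK : IsCompact (Icc 0 l ∩ f ⁻¹' (g '' Icc 0 m)) :=
    isCompact_Icc.inter_right ((isCompact_Icc.image hgc).isClosed.preimage hfc)
  have hne : (Icc 0 l ∩ f ⁻¹' (g '' Icc 0 m)).Nonempty :=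
    ⟨l, ⟨hl, le_rfl⟩, 0, ⟨le_rfl, hm⟩, by rw [hg0, hf1]⟩
  obtain ⟨t, ⟨ht, s, hs, hst⟩, hleast⟩ := hK.exists_isLeast hne
  have hfg : ∀ u ∈ Icc 0 t, ∀ v, t < v → v ≤ t + (m - s) → f u ≠ g (v - t + s) := by
    intro u hu v htv hv huv
    have hv' : v - t + s ∈ Icc 0 m := ⟨by linarith [hs.1], by linarith⟩
    have hut : t ≤ u := hleast ⟨⟨hu.1, hu.2.trans ht.2⟩, _, hv', huv.symm⟩
    obtain rfl : u = t := le_antisymm hu.2 hut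
    have := hgi hs hv' (hst.trans huv)
    linarith
  refine ⟨fun u => if u ≤ t then f u else g (u - t + s), t + (m - s),
    by linarith [ht.1, hs.2], ?_, ?_, ?_, ?_, ?_⟩
  · refine hfc.if_le (hgc.comp (by fun_prop)) continuous_id continuous_const ?_
    rintro u rfl
    simp [hst]
  · intro u hu v hv huv
    dsimp only at huv
    split_ifs at huv with h1 h2 h2
    · exact hfi ⟨hu.1, h1.trans ht.2⟩ ⟨hv.1, h2.trans ht.2⟩ huv
    · exact absurd huv (hfg u ⟨hu.1, h1⟩ v (not_le.1 h2) hv.2)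
    · exact absurd huv.symm (hfg v ⟨hv.1, h2⟩ u (not_le.1 h1) hu.2)
    · have := hgi (x₁ := u - t + s) (x₂ := v - t + s)
        ⟨by linarith [hs.1], by linarith [hu.2]⟩ ⟨by linarith [hs.1], by linarith [hv.2]⟩ huv
      linarith
  · simp [ht.1, hf0]
  · dsimp only
    split_ifs with h1
    · have : s = m := by linarith [hs.2]
      subst this
      simp [← hst, hg1]
    · simpa using hg1
  · intro u hu
    dsimp only
    split_ifs with h1
    · exact hfm ⟨hu.1, h1.trans ht.2⟩
    · exact hgm ⟨by linarith [hs.1], by linarith [hu.2]⟩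

theorem IsGeodesicSegment.mono {γ : ℝ → X} {a b c d : ℝ} (h : IsGeodesicSegment γ a b)
    (hac : a ≤ c) (hdb : d ≤ b) : IsGeodesicSegment γ c d :=
  fun s hs t ht => h s ⟨hac.trans hs.1, hs.2.trans hdb⟩ t ⟨hac.trans ht.1, ht.2.trans hdb⟩

theorem IsGeodesicSegment.reverse {γ : ℝ → X} {l : ℝ} (h : IsGeodesicSegment γ 0 l) :
    IsGeodesicSegment (fun t => γ (l - t)) 0 l := by
  intro s hs t ht
  dsimp only
  rw [h (l - s) ⟨by linarith [hs.2], by linarith [hs.1]⟩ (l - t)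
    ⟨by linarith [ht.2], by linarith [ht.1]⟩, abs_sub_comm]
  congr 1
  ring

theorem IsGeodesicSegment.continuousOn {γ : ℝ → X} {a b : ℝ} (h : IsGeodesicSegment γ a b) :
    ContinuousOn γ (Icc a b) := by
  refine LipschitzOnWith.continuousOn (K := 1) (LipschitzOnWith.of_dist_le_mul ?_)
  intro s hs t ht
  simp [h s hs t ht, Real.dist_eq]

theorem IsGeodesicSegment.arcJoined {γ : ℝ → X} {l : ℝ} {S : Set X}
    (h : IsGeodesicSegment γ 0 l) (hl : 0 ≤ l) (hS : MapsTo γ (Icc 0 l) S) :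
    ArcJoined S (γ 0) (γ l) := by
  have heq : ∀ t ∈ Icc 0 l, IccExtend hl ((Icc 0 l).domRestrict γ) t = γ t := fun t ht =>
    IccExtend_of_mem hl _ ht
  refine ⟨IccExtend hl ((Icc 0 l).domRestrict γ), l, hl, h.continuousOn.domRestrict.Icc_extend', ?_,
    heq 0 ⟨le_rfl, hl⟩, heq l ⟨hl, le_rfl⟩, fun t ht => ?_⟩
  · intro s hs t ht hst
    rw [heq s hs, heq t ht] at hst
    have := h s hs t ht
    rw [hst, dist_self] at this
    linarith [abs_eq_zero.1 this.symm]
  · rw [heq t ht]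
    exact hS ht

end ArcJoined

section TreeGraded

variable {X : Type*} [MetricSpace X] {PX : Set (Set X)} {P : Set X}

/-- Two arcs with the same endpoints, meeting only there, form a simple loop and hence lie in
one piece. -/
theorem IsTreeGraded.exists_piece_of_arcs (hTG : IsTreeGraded X PX) {f g : ℝ → X} {l m : ℝ}
    (hl : 0 < l) (hm : 0 < m) (hfc : Continuous f) (hgc : Continuous g)
    (hfi : InjOn f (Icc 0 l)) (hgi : InjOn g (Icc 0 m)) (hfg : f l = g 0) (hgf : g m = f 0)
    (hdisj : ∀ s ∈ Icc 0 l, ∀ t ∈ Ioo 0 m, f s ≠ g t) :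
    ∃ Q ∈ PX, ∀ t ∈ Icc 0 l, f t ∈ Q := by
  set h : ℝ → X := fun u => if u ≤ l then f u else g (u - l) with hh
  have hhc : Continuous h := by
    refine hfc.if_le (hgc.comp (by fun_prop)) continuous_id continuous_const ?_
    rintro u rfl
    simp [hfg]
  have hhi : InjOn h (Ico 0 (l + m)) := by
    intro u hu v hv huv
    simp only [hh] at huv
    split_ifs at huv with h1 h2 h2
    · exact hfi ⟨hu.1, h1⟩ ⟨hv.1, h2⟩ huv
    · exact absurd huv (hdisj u ⟨hu.1, h1⟩ _ ⟨by linarith, by linarith [hv.2]⟩)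
    · exact absurd huv.symm (hdisj v ⟨hv.1, h2⟩ _ ⟨by linarith, by linarith [hu.2]⟩)
    · have := hgi (x₁ := u - l) (x₂ := v - l)
        ⟨by linarith, by linarith [hu.2]⟩ ⟨by linarith, by linarith [hv.2]⟩ huv
      linarith
  have hper : h 0 = h (l + m) := by
    simp [hh, hl.le, not_le.2 hm, hgf]
  have hlm : 0 < l + m := by linarith
  have hscale : ∀ t ∈ Ico (0 : ℝ) (0 + 1), (l + m) * t ∈ Ico 0 (l + m) := fun t ht =>
    ⟨by have := ht.1; positivity, by nlinarith [ht.2]⟩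
  have : Fact ((0 : ℝ) < 1) := ⟨one_pos⟩
  obtain ⟨Q, hQ, hsub⟩ := hTG.t2 (AddCircle.liftIco (1 : ℝ) 0 fun t => h ((l + m) * t))
    (AddCircle.liftIco_continuous (by simpa using hper)
      (hhc.comp (by fun_prop)).continuousOn) (by
    intro a b hab
    obtain ⟨s, hs, rfl⟩ := AddCircle.eq_coe_Ico a
    obtain ⟨t, ht, rfl⟩ := AddCircle.eq_coe_Ico b
    rw [← zero_add (1 : ℝ)] at hs ht
    rw [AddCircle.liftIco_coe_apply hs, AddCircle.liftIco_coe_apply ht] at hab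
    rw [mul_left_cancel₀ hlm.ne' (hhi (hscale s hs) (hscale t ht) hab)])
  refine ⟨Q, hQ, fun t ht => hsub ⟨((t / (l + m) : ℝ) : AddCircle (1 : ℝ)), ?_⟩⟩
  rw [AddCircle.liftIco_coe_apply
    ⟨div_nonneg ht.1 hlm.le, by rw [zero_add, div_lt_one hlm]; linarith [ht.2]⟩]
  simp [hh, mul_div_cancel₀ t hlm.ne', ht.2]

/-- An arc meeting a piece at most at its endpoints, both in the piece, is degenerate. -/
theorem IsTreeGraded.eq_of_arcJoined (hTG : IsTreeGraded X PX) (hP : P ∈ PX) {a b : X}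
    (ha : a ∈ P) (hb : b ∈ P) (h : ArcJoined (insert a (insert b Pᶜ)) a b) : a = b := by
  by_contra hab
  obtain ⟨f, l, hl, hfc, hfi, hf0, hf1, hfm⟩ := h
  obtain ⟨γ, hγ, hγ0, hγ1, hγP⟩ := hTG.geodesicSub P hP b hb a ha
  have hg := hγ.arcJoined dist_nonneg hγP
  rw [hγ0, hγ1] at hg
  obtain ⟨g, m, hm, hgc, hgi, hg0, hg1, hgm⟩ := hg
  have hl' : 0 < l := hl.lt_of_ne fun h => hab (by rw [← hf0, ← hf1, ← h])
  have hm' : 0 < m := hm.lt_of_ne fun h => hab (by rw [← hg0, ← hg1, ← h])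
  have hend : ∀ t ∈ Icc 0 l, f t ∈ P → f t = a ∨ f t = b := by
    intro t ht htP
    rcases hfm ht with h | h | h
    · exact Or.inl h
    · exact Or.inr h
    · exact absurd htP h
  obtain ⟨Q, hQ, hsub⟩ := hTG.exists_piece_of_arcs hl' hm' hfc hgc hfi hgi (hf1.trans hg0.symm)
    (hg1.trans hf0.symm) (by
      intro s hs t ht hst
      have ht' := Ioo_subset_Icc_self ht
      rcases hend s hs (hst ▸ hgm ht') with h | h
      · exact ht.2.ne (hgi ht' ⟨hm, le_rfl⟩ (by rw [← hst, h, hg1]))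
      · exact ht.1.ne' (hgi ht' ⟨le_rfl, hm⟩ (by rw [← hst, h, hg0])))
  have hQP : Q = P := by
    by_contra hne
    exact hab (hTG.t1 Q hQ P hP hne ⟨hf0 ▸ hsub 0 ⟨le_rfl, hl⟩, ha⟩
      ⟨hf1 ▸ hsub l ⟨hl, le_rfl⟩, hb⟩)
  have hmid : l / 2 ∈ Icc 0 l := ⟨by linarith, by linarith⟩
  rcases hend (l / 2) hmid (hQP ▸ hsub _ hmid) with h | h
  · have := hfi hmid ⟨le_rfl, hl⟩ (h.trans hf0.symm)
    linarith
  · have := hfi hmid ⟨hl, le_rfl⟩ (h.trans hf1.symm)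
    linarith

/-- A point is joined to any nearest point of `P` by an arc otherwise avoiding `P`. -/
theorem GeodesicSpace.arcJoined_of_dist_eq_infDist (hgeo : GeodesicSpace X) {x p : X}
    (hp : dist x p = infDist x P) : ArcJoined (insert p Pᶜ) x p := by
  obtain ⟨γ, hγ, h0, h1⟩ := hgeo x p
  have key := hγ.arcJoined (S := insert p Pᶜ) dist_nonneg (by
    intro t ht
    by_cases htP : γ t ∈ P
    · left
      have h2 := infDist_le_dist_of_mem (x := x) htP
      have h3 := hγ 0 ⟨le_rfl, dist_nonneg⟩ t ht
      rw [h0, zero_sub, abs_neg, abs_of_nonneg ht.1] at h3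
      rw [← hp, h3] at h2
      rw [le_antisymm ht.2 h2, h1]
    · exact Or.inr htP)
  rwa [h0, h1] at key

/-- A geodesic issuing from `x` and meeting the piece `P` passes through the nearest point
of `P`. -/
theorem IsTreeGraded.exists_eq_of_meets (hTG : IsTreeGraded X PX) (hgeo : GeodesicSpace X)
    (hP : P ∈ PX) {x p : X} (hpP : p ∈ P) (hp : dist x p = infDist x P) {γ : ℝ → X} {l : ℝ}
    (hγ : IsGeodesicSegment γ 0 l) (h0 : γ 0 = x) (hmeet : ∃ t ∈ Icc 0 l, γ t ∈ P) :
    ∃ t ∈ Icc 0 l, γ t = p := by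
  have hK : IsCompact (Icc 0 l ∩ γ ⁻¹' P) :=
    isCompact_Icc.of_isClosed_subset
      (hγ.continuousOn.preimage_isClosed_of_isClosed isClosed_Icc (hTG.closed P hP))
      inter_subset_left
  obtain ⟨t, ⟨ht, htP⟩, hleast⟩ := hK.exists_isLeast hmeet
  have harc := (hγ.mono le_rfl ht.2).arcJoined (S := insert (γ t) Pᶜ) ht.1 (by
    intro u hu
    by_cases huP : γ u ∈ P
    · left
      rw [le_antisymm hu.2 (hleast ⟨⟨hu.1, hu.2.trans ht.2⟩, huP⟩)]
    · exact Or.inr huP)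
  rw [h0] at harc
  refine ⟨t, ht, hTG.eq_of_arcJoined hP htP hpP ?_⟩
  exact (harc.symm.mono (insert_subset_insert (subset_insert _ _))).trans
    ((hgeo.arcJoined_of_dist_eq_infDist hp).mono (subset_insert _ _))

end TreeGraded

/-- The nearest-point projection onto a piece of a tree-graded space is a 1-Lipschitz
retraction. -/
theorem projection_lipschitz_retraction (X : Type*) [MetricSpace X] [CompleteSpace X]
    (PX : Set (Set X)) (hgeo : GeodesicSpace X) (hTG : IsTreeGraded X PX)
    (P : Set X) (hP : P ∈ PX) (π : X → X)
    (hmem : ∀ x : X, π x ∈ P)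
    (hdist : ∀ x : X, dist x (π x) = Metric.infDist x P) :
    (∀ p ∈ P, π p = p) ∧ ∀ x y : X, dist (π x) (π y) ≤ dist x y := by
  refine ⟨fun p hp => ?_, fun x y => ?_⟩
  · have := hdist p
    rw [infDist_zero_of_mem hp, dist_eq_zero] at this
    exact this.symm
  obtain ⟨γ, hγ, h0, h1⟩ := hgeo x y
  by_cases hmeet : ∃ t ∈ Icc 0 (dist x y), γ t ∈ P
  · obtain ⟨s, hs, hsx⟩ := hTG.exists_eq_of_meets hgeo hP (hmem x) (hdist x) hγ h0 hmeet
    obtain ⟨u, hu, huP⟩ := hmeet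
    obtain ⟨t, ht, hty⟩ := hTG.exists_eq_of_meets hgeo hP (hmem y) (hdist y) hγ.reverse
      (by simpa using h1)
      ⟨dist x y - u, ⟨by linarith [hu.2], by linarith [hu.1]⟩, by simpa using huP⟩
    rw [← hsx, ← hty, hγ s hs _ ⟨by linarith [ht.2], by linarith [ht.1]⟩, abs_le]
    constructor <;> linarith [hs.1, hs.2, ht.1, ht.2]
  · have harc := hγ.arcJoined (S := Pᶜ) dist_nonneg fun t ht htP => hmeet ⟨t, ht, htP⟩
    rw [h0, h1] at harc
    have hx := hgeo.arcJoined_of_dist_eq_infDist (hdist x)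
    have hy := hgeo.arcJoined_of_dist_eq_infDist (hdist y)
    have heq : π x = π y := by
      refine hTG.eq_of_arcJoined hP (hmem x) (hmem y) ?_
      refine (hx.symm.mono (insert_subset_insert (subset_insert _ _))).trans
        (ArcJoined.trans (harc.mono ?_) (hy.mono (subset_insert _ _)))
      exact (subset_insert _ _).trans (subset_insert _ _)
    rw [heq, dist_self]
    exact dist_nonneg
end

section
/- In the Setup, for any point x ∈ X and any geodesic γ from x̂ to x: every short piece of γ has length at most 8·f(r), every long piece of γ has length at least 2r, and every reduced long piece of γ has length at least 3r/2. -/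
open Set Metric

section Chains

variable {Y : Type*}

/-- An `r`-chain from `x` to `y` inside the set `S`, with respect to the distance
function `d`: a finite sequence `x = c 0, c 1, …, c m = y` of points of `S` with
consecutive distances `< r`. -/
def IsDChain (d : Y → Y → ℝ) (r : ℝ) (S : Set Y) (x y : Y) : Prop :=
  ∃ (m : ℕ) (c : ℕ → Y), c 0 = x ∧ c m = y ∧ (∀ i ≤ m, c i ∈ S) ∧
    ∀ i < m, d (c i) (c (i + 1)) < r

/-- A set is `r`-scale connected if every two of its points are joined by an
`r`-chain contained in it. -/
def DScaleConnected (d : Y → Y → ℝ) (r : ℝ) (S : Set Y) : Prop :=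
  ∀ x ∈ S, ∀ y ∈ S, IsDChain d r S x y

/-- `C` is an `r`-scale connected component of `U`: a maximal `r`-scale connected
subset of `U`. -/
def IsDComponent (d : Y → Y → ℝ) (r : ℝ) (U C : Set Y) : Prop :=
  C ⊆ U ∧ DScaleConnected d r C ∧
    ∀ C', C ⊆ C' → C' ⊆ U → DScaleConnected d r C' → C = C'

/-- A set is `M`-bounded: its diameter is at most `M`. -/
def DBounded (d : Y → Y → ℝ) (M : ℝ) (S : Set Y) : Prop :=
  ∀ x ∈ S, ∀ y ∈ S, d x y ≤ M

/-- A space has dimension `≤ n` at scale `s` of magnitude `M` if there is a cover by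
`n + 1` sets such that every `s`-scale connected component of each of them is
`M`-bounded. -/
def DimLeAtScale (d : Y → Y → ℝ) (n : ℕ) (s M : ℝ) : Prop :=
  ∃ U : Fin (n + 1) → Set Y, (∀ y, ∃ i, y ∈ U i) ∧
    ∀ i C, IsDComponent d s (U i) C → DBounded d M C

end Chains
section TreeGradedColoring

variable {X : Type*} [MetricSpace X]

/-- The `r`-scale connected component `𝔠_P` of `c_P`-color `0` of the piece `P`
containing its base point `x_P = proj P x̂`: the set of points of `P` reachable from
`x_P` by an `r`-chain of points of `P` of `c_P`-color `0`. -/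
def pieceComp (r : ℝ) {n : ℕ} (xhat : X) (proj : Set X → X → X)
    (cP : Set X → X → Fin (n + 1)) (P : Set X) : Set X :=
  {y | IsDChain dist r {z | z ∈ P ∧ cP P z = 0} (proj P xhat) y}

/-- `P` is a long piece of the geodesic `γ : [0, L] → X` (from `x̂` to `x = γ L`):
`γ` meets `P` and the exit point `π_P x` does not belong to `𝔠_P`. -/
def IsLongPiece (PX : Set (Set X)) (r : ℝ) {n : ℕ} (xhat : X)
    (proj : Set X → X → X) (cP : Set X → X → Fin (n + 1))
    (γ : ℝ → X) (L : ℝ) (P : Set X) : Prop :=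
  P ∈ PX ∧ (∃ t ∈ Set.Icc 0 L, γ t ∈ P) ∧
    proj P (γ L) ∉ pieceComp r xhat proj cP P

/-- The parameter at which the geodesic `γ : [0, L] → X` enters the piece `P`. -/
noncomputable def pieceStart (γ : ℝ → X) (L : ℝ) (P : Set X) : ℝ :=
  sInf {t | t ∈ Set.Icc 0 L ∧ γ t ∈ P}

/-- The parameter at which the geodesic `γ : [0, L] → X` exits the piece `P`. -/
noncomputable def pieceEnd (γ : ℝ → X) (L : ℝ) (P : Set X) : ℝ :=
  sSup {t | t ∈ Set.Icc 0 L ∧ γ t ∈ P}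

/-- The complement in `γ : [0, L] → X` (in parameter space) of the interiors of all
reduced long pieces of `γ`; its connected components are the subpaths `β₁, …, β_k`. -/
noncomputable def betaSet (PX : Set (Set X)) (r : ℝ) {n : ℕ} (xhat : X)
    (proj : Set X → X → X) (cP : Set X → X → Fin (n + 1))
    (γ : ℝ → X) (L : ℝ) : Set ℝ :=
  Set.Icc 0 L \
    ⋃ P ∈ {P | IsLongPiece PX r xhat proj cP γ L P},
      Set.Ioo (pieceStart γ L P + r / 2) (pieceEnd γ L P)

/-- The length `|⌊β⌋|` of the initial part of the subpath `β = γ|[a,b]`, where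
`⌊β⌋` goes from `β₋ = γ a` to the entry point `β′` of the piece of the induced
tree-graded structure on `β` containing `β₊ = γ b`. -/
noncomputable def floorLen (PX : Set (Set X)) (γ : ℝ → X) (a b : ℝ) : ℝ :=
  sInf {t | t ∈ Set.Icc a b ∧ ∃ P ∈ PX, γ '' Set.Icc t b ⊆ P} - a

/-- `v` is the value at `x = γ L` of the coloring `c*_X` computed along the geodesic
`γ : [0, L] → X` from `x̂` to `x`:
`v = Σ_P c_P(π_P x) + Σᵢ ⌊ |⌊βᵢ⌋| / (99 f(r)) ⌋ (mod n+1)`,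
where the first sum is over the (finitely many) pieces with a nonzero term and
`β₁, …, β_k` are the connected components of the complement in `γ` of the interiors
of the reduced long pieces of `γ`. -/
def ColorValue (PX : Set (Set X)) (r fr : ℝ) {n : ℕ} (xhat : X)
    (proj : Set X → X → X) (cP : Set X → X → Fin (n + 1))
    (γ : ℝ → X) (L : ℝ) (v : Fin (n + 1)) : Prop :=
  ∃ (Ps : Finset (Set X)) (k : ℕ) (a b : Fin k → ℝ),
    (↑Ps : Set (Set X)) = {P | P ∈ PX ∧ cP P (proj P (γ L)) ≠ 0} ∧
    (∀ i, a i ≤ b i) ∧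
    (betaSet PX r xhat proj cP γ L = ⋃ i, Set.Icc (a i) (b i)) ∧
    (∀ i j, i ≠ j → b i < a j ∨ b j < a i) ∧
    (v : ℕ) =
      ((Ps.sum fun P => ((cP P (proj P (γ L)) : ℕ))) +
        (Finset.univ.sum fun i : Fin k =>
          Nat.floor (floorLen PX γ (a i) (b i) / (99 * fr)))) % (n + 1)

/-- The Setup: `X` is a geodesic metric space, tree-graded with respect to `PX`, pieces
do not contain other pieces; `n` is a positive integer, `r > 0` and `f(r) ≥ r`;
`proj P` is the nearest-point projection onto the piece `P`; `x̂` is a base point and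
`x_P = proj P x̂`; `c_P` is a coloring of each piece `P` by `n + 1` colors such that
`r`-components of every nonzero color are `f(r)`-bounded, `r`-components of color `0`
are `8 f(r)`-bounded, and `c_P` vanishes on the closed ball `B(x_P, 2r)`. -/
structure ColoringSetup (X : Type*) [MetricSpace X] (PX : Set (Set X)) (n : ℕ)
    (r fr : ℝ) (xhat : X) (proj : Set X → X → X)
    (cP : Set X → X → Fin (n + 1)) : Prop where
  geodesic : GeodesicSpace X
  treeGraded : IsTreeGraded X PX
  noPieceContainsPiece : ∀ P ∈ PX, ∀ Q ∈ PX, P ⊆ Q → P = Q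
  npos : 0 < n
  rpos : 0 < r
  rlefr : r ≤ fr
  projMem : ∀ P ∈ PX, ∀ x : X, proj P x ∈ P
  projDist : ∀ P ∈ PX, ∀ x : X, dist x (proj P x) = Metric.infDist x P
  ballZero : ∀ P ∈ PX, ∀ y ∈ P, dist y (proj P xhat) ≤ 2 * r → cP P y = 0
  nonzeroBounded : ∀ P ∈ PX, ∀ j : Fin (n + 1), j ≠ 0 →
    ∀ x y : X, IsDChain dist r {z | z ∈ P ∧ cP P z = j} x y → dist x y ≤ fr
  zeroBounded : ∀ P ∈ PX, ∀ x y : X,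
    IsDChain dist r {z | z ∈ P ∧ cP P z = 0} x y → dist x y ≤ 8 * fr

end TreeGradedColoring

theorem IsGeodesicSegment.exists_continuous_extension {X : Type*} [MetricSpace X] {γ : ℝ → X}
    {a b : ℝ} (hab : a ≤ b) (h : IsGeodesicSegment γ a b) :
    ∃ δ : ℝ → X, Continuous δ ∧ Set.EqOn δ γ (Set.Icc a b) ∧ IsGeodesicSegment δ a b := by
  have hc : ContinuousOn γ (Set.Icc a b) := by
    refine LipschitzOnWith.continuousOn (K := 1) (LipschitzOnWith.of_dist_le_mul ?_)
    intro s hs t ht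
    simp [h s hs t ht, Real.dist_eq]
  have heq : Set.EqOn (fun t => γ (Set.projIcc a b hab t)) γ (Set.Icc a b) := by
    intro t ht
    simp [Set.projIcc_of_mem hab ht]
  refine ⟨fun t => γ (Set.projIcc a b hab t), ?_, heq, ?_⟩
  · exact hc.comp_continuous (continuous_subtype_val.comp continuous_projIcc)
      fun t => (Set.projIcc a b hab t).2
  · intro s hs t ht
    rw [heq hs, heq ht, h s hs t ht]

theorem IsGeodesicSegment.injOn {X : Type*} [MetricSpace X] {γ : ℝ → X} {a b : ℝ}
    (h : IsGeodesicSegment γ a b) : Set.InjOn γ (Set.Icc a b) := by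
  intro s hs t ht hst
  have := h s hs t ht
  rw [hst, dist_self] at this
  exact sub_eq_zero.1 (abs_eq_zero.1 this.symm)

theorem IsGeodesicSegment.comp_const_sub {X : Type*} [MetricSpace X] {γ : ℝ → X} {L : ℝ}
    (h : IsGeodesicSegment γ 0 L) : IsGeodesicSegment (fun t => γ (L - t)) 0 L := by
  intro s hs t ht
  rw [h (L - s) ⟨by linarith [hs.2], by linarith [hs.1]⟩ (L - t)
    ⟨by linarith [ht.2], by linarith [ht.1]⟩, ← abs_neg]
  congr 1
  ring

/-- A closed path of length `T` without other self-intersections lies in one piece. -/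
theorem IsTreeGraded.exists_piece_of_closed_path {X : Type*} [MetricSpace X] {PX : Set (Set X)}
    (h : IsTreeGraded X PX) {f : ℝ → X} {T : ℝ} (hT : 0 < T) (hf : Continuous f)
    (hclosed : f 0 = f T) (hinj : Set.InjOn f (Set.Ico 0 T)) :
    ∃ Q ∈ PX, ∀ t ∈ Set.Ico 0 T, f t ∈ Q := by
  have : Fact ((0 : ℝ) < 1) := ⟨one_pos⟩
  let g : ℝ → X := fun u => f (T * u)
  have hscale : ∀ u ∈ Set.Ico (0 : ℝ) 1, T * u ∈ Set.Ico 0 T := fun u hu =>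
    ⟨mul_nonneg hT.le hu.1, by nlinarith [hu.2]⟩
  have hlift : ∀ u ∈ Set.Ico (0 : ℝ) 1, AddCircle.liftIco 1 0 g (u : AddCircle (1 : ℝ)) = g u :=
    fun u hu => AddCircle.liftIco_coe_apply (by simpa using hu)
  have hrep : ∀ z : AddCircle (1 : ℝ), ∃ u ∈ Set.Ico (0 : ℝ) 1, (u : AddCircle (1 : ℝ)) = z := by
    intro z
    have hz := AddCircle.coe_image_Ico_eq (1 : ℝ) 0
    have : z ∈ ((↑) : ℝ → AddCircle (1 : ℝ)) '' Set.Ico 0 (0 + 1) := by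
      rw [hz]
      trivial
    simpa using this
  obtain ⟨Q, hQ, hsub⟩ := h.t2 (AddCircle.liftIco 1 0 g)
    (AddCircle.liftIco_continuous (by simpa [g] using hclosed)
      (hf.comp (continuous_const.mul continuous_id)).continuousOn) (by
      intro z w hzw
      obtain ⟨u, hu, rfl⟩ := hrep z
      obtain ⟨v, hv, rfl⟩ := hrep w
      rw [hlift u hu, hlift v hv] at hzw
      have := hinj (hscale u hu) (hscale v hv) hzw
      rw [mul_left_cancel₀ hT.ne' this])
  refine ⟨Q, hQ, fun t ht => ?_⟩
  have hu : t / T ∈ Set.Ico (0 : ℝ) 1 := ⟨div_nonneg ht.1 hT.le, (div_lt_one hT).2 ht.2⟩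
  have := hsub ⟨_, hlift _ hu⟩
  simpa [g, mul_div_cancel₀ _ hT.ne'] using this

/-- The vertices of a triangle of arcs meeting only at their endpoints lie in one piece. -/
theorem IsTreeGraded.exists_piece_of_triangle {X : Type*} [MetricSpace X] {PX : Set (Set X)}
    (h : IsTreeGraded X PX) {f g k : ℝ → X} {A B C : ℝ} (hA : 0 < A) (hB : 0 < B) (hC : 0 < C)
    (hf : Continuous f) (hg : Continuous g) (hk : Continuous k)
    (hfi : Set.InjOn f (Set.Icc 0 A)) (hgi : Set.InjOn g (Set.Icc 0 B))
    (hki : Set.InjOn k (Set.Icc 0 C))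
    (hfg : f A = g 0) (hgk : g B = k 0) (hkf : k C = f 0)
    (hfg' : ∀ u ∈ Set.Icc 0 A, ∀ v ∈ Set.Icc 0 B, f u = g v → u = A)
    (hgk' : ∀ u ∈ Set.Icc 0 B, ∀ v ∈ Set.Icc 0 C, g u = k v → v = 0)
    (hkf' : ∀ u ∈ Set.Icc 0 C, ∀ v ∈ Set.Icc 0 A, k u = f v → v = 0) :
    ∃ Q ∈ PX, f 0 ∈ Q ∧ g 0 ∈ Q ∧ k 0 ∈ Q := by
  let F : ℝ → X := fun u =>
    if u ≤ A then f u else if u ≤ A + B then g (u - A) else k (u - (A + B))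
  have hF : Continuous F := by
    refine Continuous.if_le hf (Continuous.if_le (hg.comp (continuous_id.sub continuous_const))
      (hk.comp (continuous_id.sub continuous_const)) continuous_id continuous_const ?_)
      continuous_id continuous_const ?_
    · rintro u rfl
      simpa using hgk
    · rintro u rfl
      simpa [hB.le] using hfg
  have F1 : ∀ u, u ≤ A → F u = f u := fun u hu => by simp [F, hu]
  have F2 : ∀ u, A < u → u ≤ A + B → F u = g (u - A) := fun u hu hu' => by
    simp [F, hu', hu.not_ge]
  have F3 : ∀ u, A + B < u → F u = k (u - (A + B)) := fun u hu => by
    simp [F, hu.not_ge, (show A < u by linarith).not_ge]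
  have key : ∀ u v, 0 ≤ u → u ≤ v → v < A + B + C → F u = F v → u = v := by
    intro u v hu huv hv he
    rcases le_or_gt v A with hvA | hvA
    · rw [F1 u (huv.trans hvA), F1 v hvA] at he
      exact hfi ⟨hu, huv.trans hvA⟩ ⟨hu.trans huv, hvA⟩ he
    rcases le_or_gt v (A + B) with hvB | hvB
    · rw [F2 v hvA hvB] at he
      have hv' : v - A ∈ Set.Icc 0 B := ⟨by linarith, by linarith⟩
      rcases le_or_gt u A with huA | huA
      · rw [F1 u huA] at he
        have h1 := hfg' u ⟨hu, huA⟩ _ hv' he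
        rw [h1, hfg] at he
        have := hgi ⟨le_rfl, hB.le⟩ hv' he
        linarith
      · rw [F2 u huA (huv.trans hvB)] at he
        have := hgi ⟨by linarith, by linarith⟩ hv' he
        linarith
    · rw [F3 v hvB] at he
      have hv' : v - (A + B) ∈ Set.Icc 0 C := ⟨by linarith, by linarith⟩
      rcases le_or_gt u A with huA | huA
      · rw [F1 u huA] at he
        have h1 := hkf' _ hv' u ⟨hu, huA⟩ he.symm
        rw [h1, ← hkf] at he
        have := hki ⟨hC.le, le_rfl⟩ hv' he
        linarith
      rcases le_or_gt u (A + B) with huB | huB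
      · rw [F2 u huA huB] at he
        have := hgk' _ ⟨by linarith, by linarith⟩ _ hv' he
        linarith
      · rw [F3 u huB] at he
        have := hki ⟨by linarith, by linarith⟩ hv' he
        linarith
  obtain ⟨Q, hQ, hsub⟩ := h.exists_piece_of_closed_path (f := F) (T := A + B + C) (by positivity)
    hF (by rw [F1 0 hA.le, F3 _ (by linarith), ← hkf]; congr 1; ring) (by
      intro u hu v hv he
      rcases le_total u v with huv | huv
      · exact key u v hu.1 huv hv.2 he
      · exact (key v u hv.1 huv hu.2 he.symm).symm)
  refine ⟨Q, hQ, ?_, ?_, ?_⟩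
  · rw [← F1 0 hA.le]
    exact hsub 0 ⟨le_rfl, by positivity⟩
  · rw [← hfg, ← F1 A le_rfl]
    exact hsub A ⟨hA.le, by linarith⟩
  · have hend : F (A + B) = k 0 := by
      rw [F2 _ (by linarith) le_rfl, ← hgk]
      congr 1
      ring
    rw [← hend]
    exact hsub _ ⟨by positivity, by linarith⟩

/-- A geodesic ending at its first point in a piece ends at the nearest-point projection of its
origin onto that piece. -/
theorem IsTreeGraded.first_entry_eq_of_infDist {X : Type*} [MetricSpace X] {PX : Set (Set X)}
    (h : IsTreeGraded X PX) (hX : GeodesicSpace X) {P : Set X} (hP : P ∈ PX)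
    {γ : ℝ → X} {s : ℝ} (hs : 0 ≤ s) (hγ : IsGeodesicSegment γ 0 s) (hsP : γ s ∈ P)
    (hfirst : ∀ t ∈ Set.Icc 0 s, γ t ∈ P → t = s) {q : X} (hq : q ∈ P)
    (hdist : dist (γ 0) q = Metric.infDist (γ 0) P) : γ s = q := by
  by_contra hne
  obtain ⟨η, hη, hη0, hηD⟩ := hX (γ 0) q
  set D := dist (γ 0) q with hD
  have hD0 : 0 ≤ D := dist_nonneg
  obtain ⟨γ', hγc, hγe, hγ'⟩ := hγ.exists_continuous_extension hs
  obtain ⟨η', hηc, hηe, hη'⟩ := hη.exists_continuous_extension hD0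
  obtain ⟨ζ, hζ, hζ0, hζB, hζP⟩ := h.geodesicSub P hP q hq _ hsP
  have hBpos : 0 < dist q (γ s) := dist_pos.2 (Ne.symm hne)
  obtain ⟨ζ', hζc, hζe, hζ'⟩ := hζ.exists_continuous_extension hBpos.le
  set B := dist q (γ s) with hB
  have e1 : γ' 0 = γ 0 := hγe ⟨le_rfl, hs⟩
  have e2 : γ' s = γ s := hγe ⟨hs, le_rfl⟩
  have e3 : η' 0 = γ 0 := (hηe ⟨le_rfl, hD0⟩).trans hη0
  have e4 : η' D = q := (hηe ⟨hD0, le_rfl⟩).trans hηD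
  have e5 : ζ' 0 = q := (hζe ⟨le_rfl, hBpos.le⟩).trans hζ0
  have e6 : ζ' B = γ s := (hζe ⟨hBpos.le, le_rfl⟩).trans hζB
  have hζP' : ∀ t ∈ Set.Icc 0 B, ζ' t ∈ P := fun t ht => hζe ht ▸ hζP t ht
  have hγP : ∀ t ∈ Set.Icc 0 s, γ' t ∈ P → t = s := fun t ht htP =>
    hfirst t ht (hγe ht ▸ htP)
  have hηP : ∀ t ∈ Set.Icc 0 D, η' t ∈ P → t = D := by
    intro t ht htP
    have h1 : D ≤ dist (γ 0) (η' t) := hdist ▸ Metric.infDist_le_dist_of_mem htP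
    rw [← e3, hη' 0 ⟨le_rfl, hD0⟩ t ht, zero_sub, abs_neg, abs_of_nonneg ht.1] at h1
    exact le_antisymm ht.2 h1
  have hsame : ∀ u ∈ Set.Icc 0 s, ∀ v ∈ Set.Icc 0 D, γ' u = η' v → u = v := by
    intro u hu v hv he
    have h1 := hγ' 0 ⟨le_rfl, hs⟩ u hu
    have h2 := hη' 0 ⟨le_rfl, hD0⟩ v hv
    rw [he, e1, ← e3, h2] at h1
    simpa [abs_of_nonneg hu.1, abs_of_nonneg hv.1] using h1.symm
  have hcompact : IsCompact (Set.Icc 0 (min s D) ∩ {t | γ' t = η' t}) :=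
    isCompact_Icc.inter_right (isClosed_eq hγc hηc)
  obtain ⟨t₀, ⟨⟨ht0, htm⟩, hte : γ' t₀ = η' t₀⟩, hmax⟩ := hcompact.exists_isGreatest
    ⟨0, ⟨le_rfl, le_min hs hD0⟩, e1.trans e3.symm⟩
  have hts : t₀ ≤ s := htm.trans (min_le_left _ _)
  have htD : t₀ ≤ D := htm.trans (min_le_right _ _)
  have hts' : t₀ < s := by
    refine lt_of_le_of_ne hts fun hEq => hne ?_
    have := hηP t₀ ⟨ht0, htD⟩ (by rw [← hte, hEq, e2]; exact hsP)
    rw [← e2, ← e4, ← this, ← hEq, hte]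
  have htD' : t₀ < D := by
    refine lt_of_le_of_ne htD fun hEq => hne ?_
    have := hγP t₀ ⟨ht0, hts⟩ (by rw [hte, hEq, e4]; exact hq)
    rw [← e2, ← e4, ← this, ← hEq, hte]
  obtain ⟨Q, hQ, hQ1, hQ2, hQ3⟩ := h.exists_piece_of_triangle
    (f := fun u => η' (t₀ + u)) (g := ζ') (k := fun u => γ' (s - u))
    (A := D - t₀) (B := B) (C := s - t₀) (by linarith) hBpos (by linarith)
    (hηc.comp (continuous_const.add continuous_id)) hζc
    (hγc.comp (continuous_const.sub continuous_id))
    (by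
      intro u hu v hv he
      have := hη'.injOn (x₁ := t₀ + u) (x₂ := t₀ + v) ⟨by linarith [hu.1], by linarith [hu.2]⟩
        ⟨by linarith [hv.1], by linarith [hv.2]⟩ he
      linarith) hζ'.injOn
    (by
      intro u hu v hv he
      have := hγ'.injOn (x₁ := s - u) (x₂ := s - v) ⟨by linarith [hu.2], by linarith [hu.1]⟩
        ⟨by linarith [hv.2], by linarith [hv.1]⟩ he
      linarith)
    (by simp [e4, e5]) (by simp [e2, e6]) (by simp [hte])
    (by
      intro u hu v hv he
      have := hηP (t₀ + u) ⟨by linarith [hu.1], by linarith [hu.2]⟩ (he ▸ hζP' v hv)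
      linarith)
    (by
      intro u hu v hv he
      have := hγP (s - v) ⟨by linarith [hv.2], by linarith [hv.1]⟩ (he ▸ hζP' u hu)
      linarith)
    (by
      intro u hu v hv he
      have hu' : s - u ∈ Set.Icc 0 s := ⟨by linarith [hu.2], by linarith [hu.1]⟩
      have hv' : t₀ + v ∈ Set.Icc 0 D := ⟨by linarith [hv.1], by linarith [hv.2]⟩
      have h1 := hsame _ hu' _ hv' he
      have h2 : t₀ + v ≤ t₀ := hmax
        ⟨⟨hv'.1, le_min (h1 ▸ hu'.2) hv'.2⟩, by simpa [h1] using he⟩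
      linarith [hv.1])
  simp only [add_zero, sub_zero, e5, e2] at hQ1 hQ2 hQ3
  have hPQ : P = Q := by
    by_contra hPQ
    exact hne (h.t1 P hP Q hQ hPQ ⟨hsP, hQ3⟩ ⟨hq, hQ2⟩)
  have := hηP t₀ ⟨ht0, htD⟩ (hPQ ▸ hQ1)
  linarith

/-- A geodesic meeting a piece enters it at the nearest-point projection of its origin. -/
theorem IsTreeGraded.exists_isLeast_entry {X : Type*} [MetricSpace X] {PX : Set (Set X)}
    (h : IsTreeGraded X PX) (hX : GeodesicSpace X) {P : Set X} (hP : P ∈ PX)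
    {γ : ℝ → X} {L : ℝ} (hL : 0 ≤ L) (hγ : IsGeodesicSegment γ 0 L)
    (hmeet : ∃ t ∈ Set.Icc 0 L, γ t ∈ P) {q : X} (hq : q ∈ P)
    (hdist : dist (γ 0) q = Metric.infDist (γ 0) P) :
    ∃ s, IsLeast {t | t ∈ Set.Icc 0 L ∧ γ t ∈ P} s ∧ γ s = q := by
  obtain ⟨δ, hδc, hδe, -⟩ := hγ.exists_continuous_extension hL
  have hset : {t | t ∈ Set.Icc 0 L ∧ γ t ∈ P} = Set.Icc 0 L ∩ δ ⁻¹' P := by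
    ext t
    exact and_congr_right fun ht => by rw [Set.mem_preimage, hδe ht]
  have hcompact : IsCompact {t | t ∈ Set.Icc 0 L ∧ γ t ∈ P} :=
    hset ▸ isCompact_Icc.inter_right ((h.closed P hP).preimage hδc)
  obtain ⟨s, hs⟩ := hcompact.exists_isLeast hmeet
  obtain ⟨⟨⟨hs0, hsL⟩, hsP⟩, hmin⟩ := hs
  refine ⟨s, ⟨⟨⟨hs0, hsL⟩, hsP⟩, hmin⟩, ?_⟩
  refine h.first_entry_eq_of_infDist hX hP hs0 (fun u hu v hv =>
    hγ u ⟨hu.1, hu.2.trans hsL⟩ v ⟨hv.1, hv.2.trans hsL⟩) hsP (fun t ht htP => ?_) hq hdist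
  exact le_antisymm ht.2 (hmin ⟨⟨ht.1, ht.2.trans hsL⟩, htP⟩)

/-- The length of the intersection of a geodesic with a piece is the distance between the
projections of its endpoints. -/
theorem IsTreeGraded.pieceEnd_sub_pieceStart {X : Type*} [MetricSpace X] {PX : Set (Set X)}
    (h : IsTreeGraded X PX) (hX : GeodesicSpace X) {P : Set X} (hP : P ∈ PX)
    {γ : ℝ → X} {L : ℝ} (hL : 0 ≤ L) (hγ : IsGeodesicSegment γ 0 L)
    (hmeet : ∃ t ∈ Set.Icc 0 L, γ t ∈ P) {p q : X} (hp : p ∈ P) (hq : q ∈ P)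
    (hpdist : dist (γ 0) p = Metric.infDist (γ 0) P)
    (hqdist : dist (γ L) q = Metric.infDist (γ L) P) :
    pieceEnd γ L P - pieceStart γ L P = dist p q := by
  obtain ⟨s, hs, rfl⟩ := h.exists_isLeast_entry hX hP hL hγ hmeet hp hpdist
  obtain ⟨t₁, ht₁, ht₁P⟩ := hmeet
  obtain ⟨e, he, rfl⟩ := h.exists_isLeast_entry hX hP hL hγ.comp_const_sub
    ⟨L - t₁, ⟨by linarith [ht₁.2], by linarith [ht₁.1]⟩, by simpa using ht₁P⟩ hq
    (by simpa using hqdist)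
  have he' : IsGreatest {t | t ∈ Set.Icc 0 L ∧ γ t ∈ P} (L - e) := by
    obtain ⟨⟨⟨he0, heL⟩, heP⟩, hmin⟩ := he
    refine ⟨⟨⟨by linarith, by linarith⟩, heP⟩, fun t ht => ?_⟩
    have : e ≤ L - t := hmin
      ⟨⟨by linarith [ht.1.2], by linarith [ht.1.1]⟩, by simpa using ht.2⟩
    linarith
  rw [pieceEnd, pieceStart, he'.csSup_eq, hs.csInf_eq, hγ s hs.1.1 _ he'.1.1, abs_sub_comm,
    abs_of_nonneg (sub_nonneg.2 (hs.2 he'.1))]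

/-- Points of a piece at distance less than `2r` from its base point lie in the component of
the base point. -/
theorem ColoringSetup.mem_pieceComp_of_dist_lt {X : Type*} [MetricSpace X] {PX : Set (Set X)}
    {n : ℕ} {r fr : ℝ} {xhat : X} {proj : Set X → X → X} {cP : Set X → X → Fin (n + 1)}
    (h : ColoringSetup X PX n r fr xhat proj cP) {P : Set X} (hP : P ∈ PX) {y : X} (hy : y ∈ P)
    (hdist : dist (proj P xhat) y < 2 * r) : y ∈ pieceComp r xhat proj cP P := by
  obtain ⟨ζ, hζ, hζ0, hζB, hζP⟩ := h.treeGraded.geodesicSub P hP _ (h.projMem P hP xhat) y hy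
  set D := dist (proj P xhat) y
  have hD : 0 ≤ D := dist_nonneg
  have hr := h.rpos
  have hmem : ∀ i ≤ 2, ((i : ℕ) : ℝ) * (D / 2) ∈ Set.Icc 0 D := by
    intro i hi
    have : ((i : ℕ) : ℝ) ≤ 2 := by exact_mod_cast hi
    exact ⟨by positivity, by nlinarith⟩
  refine ⟨2, fun i => ζ (i * (D / 2)), by simpa using hζ0, ?_, fun i hi => ?_, fun i hi => ?_⟩
  · have htwo : ((2 : ℕ) : ℝ) * (D / 2) = D := by
      push_cast
      ring
    simp only [htwo, hζB]
  · have hi' := hmem i hi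
    refine ⟨hζP _ hi', h.ballZero P hP _ (hζP _ hi') ?_⟩
    rw [← hζ0, hζ _ hi' 0 ⟨le_rfl, hD⟩, sub_zero, abs_of_nonneg hi'.1]
    linarith [hi'.2]
  · rw [hζ _ (hmem i hi.le) _ (hmem (i + 1) hi)]
    push_cast
    rw [show (i : ℝ) * (D / 2) - (i + 1) * (D / 2) = -(D / 2) by ring, abs_neg,
      abs_of_nonneg (by linarith)]
    linarith

/-- In the Setup, along any geodesic `γ` from `x̂` to `x`: every short piece of `γ` has
length at most `8·f(r)`, every long piece has length at least `2r`, and every reduced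
long piece has length at least `3r/2`. -/
theorem short_and_long_piece_lengths (X : Type*) [MetricSpace X] [CompleteSpace X]
    (PX : Set (Set X)) (n : ℕ) (r fr : ℝ) (xhat : X)
    (proj : Set X → X → X) (cP : Set X → X → Fin (n + 1))
    (hsetup : ColoringSetup X PX n r fr xhat proj cP)
    (x : X) (γ : ℝ → X) (L : ℝ) (hL : 0 ≤ L)
    (hγ : IsGeodesicSegment γ 0 L) (hγ0 : γ 0 = xhat) (hγL : γ L = x)
    (P : Set X) (hP : P ∈ PX) (hmeet : ∃ t ∈ Set.Icc (0 : ℝ) L, γ t ∈ P) :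
    (proj P x ∈ pieceComp r xhat proj cP P →
      pieceEnd γ L P - pieceStart γ L P ≤ 8 * fr) ∧
    (proj P x ∉ pieceComp r xhat proj cP P →
      2 * r ≤ pieceEnd γ L P - pieceStart γ L P ∧
      3 * r / 2 ≤ pieceEnd γ L P - (pieceStart γ L P + r / 2)) := by
  subst hγ0 hγL
  have hlen := hsetup.treeGraded.pieceEnd_sub_pieceStart hsetup.geodesic hP hL hγ hmeet
    (hsetup.projMem P hP _) (hsetup.projMem P hP _) (hsetup.projDist P hP _)
    (hsetup.projDist P hP _)
  refine ⟨fun hshort => hlen ▸ hsetup.zeroBounded P hP _ _ hshort, fun hlong => ?_⟩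
  have hle : 2 * r ≤ pieceEnd γ L P - pieceStart γ L P := by
    rw [hlen]
    by_contra! hlt
    exact hlong (hsetup.mem_pieceComp_of_dist_lt hP (hsetup.projMem P hP _) hlt)
  exact ⟨hle, by linarith⟩
end
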